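/- arXiv:1704.05616 — 2 statements merged into one kernel-verified Lean document; each statement's English description precedes it below -/
import Mathlib

section
/- Let μ₁, μ₂ ∈ M(X,T) with ergodic decompositions α₁, α₂ (Borel probability measures on M(X,T)). Then ‖μ₁ − μ₂‖ = ‖α₁ − α₂‖, where the norms are the dual norms on C(X)* and C(M(X,T))* respectively. -/
open MeasureTheory Set Topology

variable {X : Type*} [MetricSpace X] [CompactSpace X] [MeasurableSpace X] [BorelSpace X]

/-- The set of `T`-invariant Borel probability measures on `X`. -/
noncomputable def invSet (T : X → X) : Set (ProbabilityMeasure X) :=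
  {μ | (μ : Measure X).map T = (μ : Measure X)}

/-- `Q φ = max_{μ ∈ M(X,T)} ∫ φ dμ` (as a supremum). -/
noncomputable def QFun (T : X → X) (φ : C(X, ℝ)) : ℝ :=
  sSup ((fun μ : ProbabilityMeasure X => ∫ x, φ x ∂(μ : Measure X)) '' invSet T)

/-- The set of `φ`-maximizing measures. -/
noncomputable def maxSet (T : X → X) (φ : C(X, ℝ)) : Set (ProbabilityMeasure X) :=
  {μ | μ ∈ invSet T ∧ ∫ x, φ x ∂(μ : Measure X) = QFun T φ}

/-- The set of ergodic `T`-invariant Borel probability measures. -/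
def ergSet (T : X → X) : Set (ProbabilityMeasure X) :=
  {μ | Ergodic T (μ : Measure X)}

/-- Support of a measure: the intersection of all closed sets of full measure. -/
noncomputable def msupport {Y : Type*} [TopologicalSpace Y] [MeasurableSpace Y]
    (α : Measure Y) : Set Y :=
  ⋂₀ {C | IsClosed C ∧ α C = 1}

/-- `S` is arcwise-connected: any two points are joined by a homeomorphism-onto-image
path inside `S`. -/
def ArcConnIn {A : Type*} [TopologicalSpace A] (S : Set A) : Prop :=
  ∀ μ ∈ S, ∀ ν ∈ S, ∃ f : unitInterval → A,
    Topology.IsEmbedding f ∧ Set.range f ⊆ S ∧ f 0 = μ ∧ f 1 = ν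

/-- The dual norm of the difference of two measures, via bounded continuous functions. -/
noncomputable def dualDist {Y : Type*} [TopologicalSpace Y] [MeasurableSpace Y]
    (μ ν : Measure Y) : ℝ :=
  sSup {r : ℝ | ∃ h : BoundedContinuousFunction Y ℝ, ‖h‖ ≤ 1 ∧
    r = |∫ y, h y ∂μ - ∫ y, h y ∂ν|}

open Filter

lemma aux_mean (T : X → X) (m : ProbabilityMeasure X) (h : Ergodic T (m : Measure X))
    (φ : C(X, ℝ)) :
    TendstoInMeasure (m : Measure X) (fun n x => birkhoffAverage ℝ T φ n x) atTop
      (fun _ => ∫ x, φ x ∂(m : Measure X)) := by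
  have hφ : MemLp φ 2 (m : Measure X) :=
    MemLp.of_bound φ.continuous.aestronglyMeasurable ‖φ‖ (ae_of_all _ fun x => φ.norm_coe_le_norm x)
  let K : Lp ℝ 2 (m : Measure X) →L[ℝ] Lp ℝ 2 (m : Measure X) :=
    (Lp.compMeasurePreservingₗᵢ ℝ T h.toMeasurePreserving).toContinuousLinearMap
  have hK : ‖K‖ ≤ 1 := LinearIsometry.norm_toContinuousLinearMap_le _
  have hlim := K.tendsto_birkhoffAverage_orthogonalProjection hK hφ.toLp
  set g := (K.eqLocus ((1 : Lp ℝ 2 (m : Measure X) →L[ℝ] Lp ℝ 2 (m : Measure X)) : Lp ℝ 2 (m : Measure X) →ₗ[ℝ] Lp ℝ 2 (m : Measure X))).orthogonalProjectionOnto hφ.toLp with hg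
  have hgK : K (g : Lp ℝ 2 (m : Measure X)) = g := g.2
  have hco : ∀ f : Lp ℝ 2 (m : Measure X), K f =ᵐ[(m : Measure X)] f ∘ T := fun f =>
    Lp.coeFn_compMeasurePreserving f h.toMeasurePreserving
  obtain ⟨c, hc⟩ := h.ae_eq_const_of_ae_eq_comp_ae (Lp.aestronglyMeasurable (g : Lp ℝ 2 (m : Measure X)))
    (by have := hco g; rw [hgK] at this; exact this.symm)
  have h1 : MemLp (fun _ : X => (1:ℝ)) 2 (m : Measure X) := memLp_const 1
  have h1K : K h1.toLp = h1.toLp := by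
    exact Lp.toLp_compMeasurePreserving h1 h.toMeasurePreserving
  have hcφ : c = ∫ x, φ x ∂(m : Measure X) := by
    have h2 := Submodule.starProjection_inner_eq_zero (K := K.eqLocus ((1 : Lp ℝ 2 (m : Measure X) →L[ℝ] Lp ℝ 2 (m : Measure X)) : Lp ℝ 2 (m : Measure X) →ₗ[ℝ] Lp ℝ 2 (m : Measure X))) (hφ.toLp) h1.toLp h1K
    rw [Submodule.starProjection_apply, ← hg, L2.inner_def] at h2
    have h3 : ∫ x, (φ x - c) ∂(m : Measure X) = 0 := by
      rw [← h2]
      refine integral_congr_ae ?_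
      filter_upwards [Lp.coeFn_sub hφ.toLp (g : Lp ℝ 2 (m : Measure X)), h1.coeFn_toLp, hφ.coeFn_toLp, hc] with x a1 a2 a3 a4
      rw [a1, a2, Pi.sub_apply, a3, a4]; simp
    rw [integral_sub (hφ.integrable (by norm_num)) (integrable_const _)] at h3
    simp at h3; linarith
  have hit : ∀ i : ℕ, (K^[i] hφ.toLp : Lp ℝ 2 (m : Measure X)) =ᵐ[(m : Measure X)] fun x => φ (T^[i] x) := by
    intro i
    induction i with
    | zero => exact hφ.coeFn_toLp
    | succ i ih =>
      rw [Function.iterate_succ_apply']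
      filter_upwards [hco (K^[i] hφ.toLp), h.toMeasurePreserving.quasiMeasurePreserving.ae ih] with x a b
      rw [a, Function.comp, b, Function.iterate_succ_apply]
  refine (tendstoInMeasure_of_tendsto_Lp hlim).congr (fun n => ?_) (by rw [← hcφ]; exact hc)
  have hs : ((birkhoffSum K _root_.id n hφ.toLp : Lp ℝ 2 (m : Measure X)) : X → ℝ) =ᵐ[(m : Measure X)] fun x => birkhoffSum T φ n x := by
    induction n with
    | zero =>
      filter_upwards [Lp.coeFn_zero ℝ 2 (m : Measure X)] with x hx
      rw [birkhoffSum_zero, birkhoffSum_zero, hx, Pi.zero_apply]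
    | succ n ih =>
      rw [birkhoffSum_succ]
      filter_upwards [Lp.coeFn_add (birkhoffSum K _root_.id n hφ.toLp) (K^[n] hφ.toLp), ih, hit n] with x a b d
      rw [birkhoffSum_succ, id, a, Pi.add_apply, b, d]
  filter_upwards [Lp.coeFn_smul ((n:ℝ)⁻¹) (birkhoffSum K _root_.id n hφ.toLp), hs] with x a b
  rw [birkhoffAverage, a, Pi.smul_apply, b]; rfl

/-- Empirical measure. -/
noncomputable def empMeas (T : X → X) (n : ℕ) (x : X) : ProbabilityMeasure X :=
  ⟨((n + 1 : ℕ) : ENNReal)⁻¹ • ∑ i ∈ Finset.range (n + 1), Measure.dirac (T^[i] x), ⟨by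
    simp only [Measure.smul_apply, Measure.coe_finsetSum, Finset.sum_apply, measure_univ,
      Finset.sum_const, Finset.card_range, smul_eq_mul, nsmul_eq_mul, mul_one]
    exact ENNReal.inv_mul_cancel (by simp) (by simp)⟩⟩

lemma integral_empMeas (T : X → X) (n : ℕ) (x : X) (φ : BoundedContinuousFunction X ℝ) :
    ∫ y, φ y ∂(empMeas T n x : Measure X) = birkhoffAverage ℝ T φ (n + 1) x := by
  simp only [empMeas, ProbabilityMeasure.coe_mk]
  rw [integral_smul_measure, integral_finsetSum_measure]
  · simp only [birkhoffAverage, birkhoffSum, integral_dirac, ENNReal.toReal_inv, ENNReal.toReal_natCast]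
  · intro i _
    exact φ.integrable _

lemma continuous_empMeas (T : X → X) (hT : Continuous T) (n : ℕ) :
    Continuous (empMeas T n) := by
  rw [ProbabilityMeasure.continuous_iff_forall_continuous_integral]
  intro φ
  simp only [integral_empMeas, birkhoffAverage, birkhoffSum]
  have := fun i => hT.iterate i
  fun_prop

/-- Filter on `ℕ × X` encoding convergence in measure. -/
def inMeasFilter (m : Measure X) : Filter (ℕ × X) where
  sets := {S | Tendsto (fun n => m {x | (n, x) ∉ S}) atTop (𝓝 0)}
  univ_sets := by simp
  sets_of_superset := by
    intro S S' hS hSS'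
    exact tendsto_of_tendsto_of_tendsto_of_le_of_le tendsto_const_nhds hS (fun _ => zero_le)
      (fun n => measure_mono fun x hx hx' => hx (hSS' hx'))
  inter_sets := by
    intro S S' hS hS'
    have := Tendsto.add hS hS'
    rw [add_zero] at this
    refine tendsto_of_tendsto_of_tendsto_of_le_of_le tendsto_const_nhds this (fun _ => zero_le)
      (fun n => le_trans (measure_mono ?_) (measure_union_le _ _))
    intro x hx
    by_contra hcon
    simp only [mem_union, mem_ofPred_eq, not_or, not_not] at hcon
    exact hx hcon

lemma mem_inMeasFilter {m : Measure X} {S : Set (ℕ × X)} :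
    S ∈ inMeasFilter m ↔ Tendsto (fun n => m {x | (n, x) ∉ S}) atTop (𝓝 0) := Iff.rfl

lemma tendsto_empMeas (T : X → X) (m : ProbabilityMeasure X) (h : Ergodic T (m : Measure X)) :
    Tendsto (fun p : ℕ × X => empMeas T p.1 p.2) (inMeasFilter (m : Measure X)) (𝓝 m) := by
  rw [ProbabilityMeasure.tendsto_iff_forall_integral_tendsto]
  intro φ
  have h1 := aux_mean T m h φ.toContinuousMap
  rw [EMetric.tendsto_nhds]
  intro ε hε
  have h2 := (h1 ε hε).comp (tendsto_add_atTop_nat 1)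
  refine h2.congr fun n => ?_
  simp only [Function.comp, integral_empMeas]
  congr 1
  ext x
  simp

lemma tendsto_integral_comp_empMeas (T : X → X) (hT : Continuous T) (m : ProbabilityMeasure X)
    (h : Ergodic T (m : Measure X)) (f : BoundedContinuousFunction (ProbabilityMeasure X) ℝ) :
    Tendsto (fun n => ∫ x, f (empMeas T n x) ∂(m : Measure X)) atTop (𝓝 (f m)) := by
  have h1 := (f.continuous.tendsto m).comp (tendsto_empMeas T m h)
  have hmeas : TendstoInMeasure (m : Measure X) (fun n x => f (empMeas T n x)) atTop
      (fun _ => f m) := by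
    intro ε hε
    have := mem_inMeasFilter.1 (EMetric.tendsto_nhds.1 h1 ε hε)
    refine this.congr fun n => ?_
    congr 1
    ext x
    simp
  refine tendsto_of_subseq_tendsto fun ns hns => ?_
  obtain ⟨ms, -, hms⟩ := TendstoInMeasure.exists_seq_tendsto_ae
    (f := fun k x => f (empMeas T (ns k) x)) (g := fun _ => f m) (μ := (m : Measure X))
    (fun ε hε => (hmeas ε hε).comp hns)
  refine ⟨ms, ?_⟩
  have := tendsto_integral_of_dominated_convergence (μ := (m : Measure X))
    (F := fun k x => f (empMeas T (ns (ms k)) x)) (f := fun _ => f m) (fun _ => ‖f‖)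
    (fun k => (f.continuous.comp (continuous_empMeas T hT _)).aestronglyMeasurable)
    (integrable_const _) (fun k => ae_of_all _ fun x => f.norm_coe_le_norm _) hms
  simpa using this

lemma tendsto_integral_dec [MeasurableSpace (ProbabilityMeasure X)]
    [BorelSpace (ProbabilityMeasure X)]
    (T : X → X) (hT : Continuous T) (μ : ProbabilityMeasure X)
    (α : ProbabilityMeasure (ProbabilityMeasure X))
    (hconc : (α : Measure (ProbabilityMeasure X)) {ν | ν ∉ ergSet T} = 0)
    (hdec : ∀ φ : C(X, ℝ), ∫ x, φ x ∂(μ : Measure X) =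
      ∫ m, (∫ x, φ x ∂(m : Measure X) : ℝ) ∂(α : Measure (ProbabilityMeasure X)))
    (f : BoundedContinuousFunction (ProbabilityMeasure X) ℝ) :
    Tendsto (fun n => ∫ x, f (empMeas T n x) ∂(μ : Measure X)) atTop
      (𝓝 (∫ m, f m ∂(α : Measure (ProbabilityMeasure X)))) := by
  have e : ∀ n, ∫ x, f (empMeas T n x) ∂(μ : Measure X) =
      ∫ m, (∫ x, f (empMeas T n x) ∂(m : Measure X) : ℝ) ∂(α : Measure (ProbabilityMeasure X)) :=
    fun n => hdec ⟨fun x => f (empMeas T n x), f.continuous.comp (continuous_empMeas T hT _)⟩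
  simp_rw [e]
  refine tendsto_integral_of_dominated_convergence (fun _ => ‖f‖) (fun n => ?_)
    (integrable_const _) (fun n => ae_of_all _ fun m => ?_) ?_
  · exact (ProbabilityMeasure.continuous_integral_boundedContinuousFunction
      (f.compContinuous ⟨empMeas T n, continuous_empMeas T hT n⟩)).aestronglyMeasurable
  · refine (norm_integral_le_of_norm_le_const (C := ‖f‖) (ae_of_all _ fun x =>
      f.norm_coe_le_norm _)).trans ?_
    simp
  · have : ∀ᵐ m ∂(α : Measure (ProbabilityMeasure X)), m ∈ ergSet T := hconc
    filter_upwards [this] with m hm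
    exact tendsto_integral_comp_empMeas T hT m hm f

lemma norm_integral_le_one {Y : Type*} [TopologicalSpace Y] [MeasurableSpace Y]
    (μ : Measure Y) [IsProbabilityMeasure μ] (h : BoundedContinuousFunction Y ℝ) (hh : ‖h‖ ≤ 1) :
    |∫ y, h y ∂μ| ≤ 1 := by
  have := norm_integral_le_of_norm_le_const (μ := μ) (f := h) (C := 1)
    (ae_of_all _ fun x => (h.norm_coe_le_norm x).trans hh)
  simpa using this

lemma le_dualDist {Y : Type*} [TopologicalSpace Y] [MeasurableSpace Y]
    (μ ν : Measure Y) [IsProbabilityMeasure μ] [IsProbabilityMeasure ν]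
    (h : BoundedContinuousFunction Y ℝ) (hh : ‖h‖ ≤ 1) :
    |∫ y, h y ∂μ - ∫ y, h y ∂ν| ≤ dualDist μ ν := by
  refine le_csSup ⟨2, ?_⟩ ⟨h, hh, rfl⟩
  rintro r ⟨h, hh, rfl⟩
  have a := norm_integral_le_one μ h hh
  have b := norm_integral_le_one ν h hh
  rw [abs_le] at *
  constructor <;> linarith

lemma dualDist_le {Y : Type*} [TopologicalSpace Y] [MeasurableSpace Y]
    (μ ν : Measure Y) (c : ℝ)
    (hc : ∀ h : BoundedContinuousFunction Y ℝ, ‖h‖ ≤ 1 → |∫ y, h y ∂μ - ∫ y, h y ∂ν| ≤ c) :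
    dualDist μ ν ≤ c := by
  refine csSup_le ⟨_, 0, by simp, rfl⟩ ?_
  rintro r ⟨h, hh, rfl⟩
  exact hc h hh

/-- The ergodic decomposition map is an isometry: `‖μ₁ - μ₂‖ = ‖α₁ - α₂‖` for the
respective dual norms. -/
theorem stmt16 [MeasurableSpace (ProbabilityMeasure X)] [BorelSpace (ProbabilityMeasure X)]
    (T : X → X) (hT : Continuous T)
    (μ₁ μ₂ : ProbabilityMeasure X) (hμ₁ : μ₁ ∈ invSet T) (hμ₂ : μ₂ ∈ invSet T)
    (α₁ α₂ : ProbabilityMeasure (ProbabilityMeasure X))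
    (hconc₁ : (α₁ : Measure (ProbabilityMeasure X)) {ν | ν ∉ ergSet T} = 0)
    (hconc₂ : (α₂ : Measure (ProbabilityMeasure X)) {ν | ν ∉ ergSet T} = 0)
    (hdec₁ : ∀ φ : C(X, ℝ), ∫ x, φ x ∂(μ₁ : Measure X) =
      ∫ m, (∫ x, φ x ∂(m : Measure X) : ℝ) ∂(α₁ : Measure (ProbabilityMeasure X)))
    (hdec₂ : ∀ φ : C(X, ℝ), ∫ x, φ x ∂(μ₂ : Measure X) =
      ∫ m, (∫ x, φ x ∂(m : Measure X) : ℝ) ∂(α₂ : Measure (ProbabilityMeasure X))) :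
    dualDist (μ₁ : Measure X) (μ₂ : Measure X) =
      dualDist (α₁ : Measure (ProbabilityMeasure X)) (α₂ : Measure (ProbabilityMeasure X)) := by

  apply le_antisymm
  · refine dualDist_le _ _ _ fun h hh => ?_
    rw [show ∫ y, h y ∂(μ₁ : Measure X) = _ from hdec₁ h.toContinuousMap,
      show ∫ y, h y ∂(μ₂ : Measure X) = _ from hdec₂ h.toContinuousMap]
    have hb : ∀ m : ProbabilityMeasure X, ‖∫ x, h x ∂(m : Measure X)‖ ≤ 1 :=
      fun m => norm_integral_le_one _ h hh
    exact le_dualDist _ _ (BoundedContinuousFunction.ofNormedAddCommGroup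
      (fun m : ProbabilityMeasure X => ∫ x, h x ∂(m : Measure X))
      (ProbabilityMeasure.continuous_integral_boundedContinuousFunction h) 1 hb)
      (BoundedContinuousFunction.norm_ofNormedAddCommGroup_le _ zero_le_one hb)
  · refine dualDist_le _ _ _ fun f hf => ?_
    have h1 := tendsto_integral_dec T hT μ₁ α₁ hconc₁ hdec₁ f
    have h2 := tendsto_integral_dec T hT μ₂ α₂ hconc₂ hdec₂ f
    refine le_of_tendsto (h1.sub h2).abs (Eventually.of_forall fun n => ?_)
    refine le_dualDist _ _ (f.compContinuous ⟨empMeas T n, continuous_empMeas T hT n⟩) ?_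
    exact (BoundedContinuousFunction.norm_compContinuous_le _ _).trans hf
end

section
/- (Theorem B) Let (X,T) be a topologically mixing subshift of finite type. Then there is a dense subset D of C(X) such that for every φ ∈ D, the set of ergodic φ-maximizing measures that are fully supported and have positive metric entropy is uncountable. -/
open MeasureTheory Set Topology ENNReal

variable {X : Type*} [MetricSpace X] [CompactSpace X] [MeasurableSpace X] [BorelSpace X]

/-- The Shannon entropy of a finite family of sets with respect to a measure. -/
noncomputable def partEnt (μ : Measure X) (P : Finset (Set X)) : ℝ :=
  ∑ A ∈ P, Real.negMulLog ((μ A).toReal)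

/-- The join `P ∨ T⁻¹ P ∨ ⋯ ∨ T⁻⁽ⁿ⁻¹⁾ P` of a finite family of sets under iteration. -/
noncomputable def refineIter (T : X → X) (P : Finset (Set X)) (n : ℕ) : Finset (Set X) := by
  classical
  exact (Fintype.piFinset fun _ : Fin n => P).image fun g => ⋂ i : Fin n, T^[(i : ℕ)] ⁻¹' g i

/-- A finite measurable partition of `X`. -/
def IsMeasPartition (P : Finset (Set X)) : Prop :=
  (∀ A ∈ P, MeasurableSet A) ∧ (⋃ A ∈ P, A) = Set.univ ∧
    (P : Set (Set X)).PairwiseDisjoint id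

/-- The Kolmogorov–Sinai (metric) entropy of `T` with respect to `μ`: the supremum over
finite measurable partitions of the entropy rate (given by subadditivity as an infimum). -/
noncomputable def ksEntropy (T : X → X) (μ : Measure X) : ℝ≥0∞ :=
  ⨆ P : {P : Finset (Set X) // IsMeasPartition P},
    ⨅ n : ℕ, ENNReal.ofReal (partEnt μ (refineIter T P.1 (n + 1)) / (n + 1))


section Aux

lemma aux_integrable (a : C(X, ℝ)) (μ : Measure X) [IsFiniteMeasure μ] :
    Integrable (fun x => a x) μ :=
  a.continuous.integrable_of_hasCompactSupport (HasCompactSupport.of_compactSpace _)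

lemma aux_abs_le (a : C(X, ℝ)) (μ : ProbabilityMeasure X) :
    |∫ x, a x ∂(μ : Measure X)| ≤ ‖a‖ := by
  have := norm_integral_le_of_norm_le_const (μ := (μ : Measure X)) (f := fun x => a x) (C := ‖a‖)
    (Filter.Eventually.of_forall fun x => a.norm_coe_le_norm x)
  simpa using this

lemma aux_le_Q {T : X → X} (φ : C(X, ℝ)) {μ : ProbabilityMeasure X} (hμ : μ ∈ invSet T) :
    ∫ x, φ x ∂(μ : Measure X) ≤ QFun T φ := by
  refine le_csSup ⟨‖φ‖, ?_⟩ ⟨μ, hμ, rfl⟩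
  rintro _ ⟨ν, -, rfl⟩
  exact (abs_le.1 (aux_abs_le φ ν)).2

lemma aux_Q_le {T : X → X} (hne : (invSet T).Nonempty) (φ : C(X, ℝ)) {c : ℝ}
    (h : ∀ μ ∈ invSet T, ∫ x, φ x ∂(μ : Measure X) ≤ c) : QFun T φ ≤ c := by
  refine csSup_le (hne.image _) ?_
  rintro _ ⟨ν, hν, rfl⟩
  exact h ν hν

lemma aux_Q_add {T : X → X} (hne : (invSet T).Nonempty) (φ ψ : C(X, ℝ)) :
    QFun T (φ + ψ) ≤ QFun T φ + QFun T ψ := by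
  refine aux_Q_le hne _ fun μ hμ => ?_
  have := integral_add (aux_integrable φ (μ : Measure X)) (aux_integrable ψ (μ : Measure X))
  simp only [ContinuousMap.add_apply]
  rw [this]
  exact add_le_add (aux_le_Q φ hμ) (aux_le_Q ψ hμ)

lemma aux_Q_norm {T : X → X} (hne : (invSet T).Nonempty) (φ : C(X, ℝ)) : QFun T φ ≤ ‖φ‖ :=
  aux_Q_le hne _ fun μ _ => (abs_le.1 (aux_abs_le φ μ)).2

lemma aux_Q_smul_le {T : X → X} (hne : (invSet T).Nonempty) (c : ℝ) (hc : 0 < c) (φ : C(X, ℝ)) :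
    QFun T (c • φ) ≤ c * QFun T φ := by
  refine aux_Q_le hne _ fun μ hμ => ?_
  simp only [ContinuousMap.smul_apply, smul_eq_mul, integral_const_mul]
  exact mul_le_mul_of_nonneg_left (aux_le_Q φ hμ) hc.le

lemma aux_Q_smul {T : X → X} (hne : (invSet T).Nonempty) (c : ℝ) (hc : 0 < c) (φ : C(X, ℝ)) :
    QFun T (c • φ) = c * QFun T φ := by
  refine le_antisymm (aux_Q_smul_le hne c hc φ) ?_
  have := aux_Q_smul_le hne c⁻¹ (by positivity) (c • φ)
  rw [smul_smul, inv_mul_cancel₀ hc.ne', one_smul] at this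
  calc c * QFun T φ ≤ c * (c⁻¹ * QFun T (c • φ)) := by gcongr
    _ = _ := by field_simp

lemma aux_Q_lip {T : X → X} (hne : (invSet T).Nonempty) (φ ψ : C(X, ℝ)) :
    QFun T φ ≤ QFun T ψ + ‖φ - ψ‖ := by
  have h1 := aux_Q_add hne ψ (φ - ψ)
  have h2 := aux_Q_norm hne (φ - ψ)
  rw [add_sub_cancel] at h1
  linarith

/-- Riesz representation: a linear functional below `Q` is an invariant measure. -/
lemma aux_riesz {T : X → X} (hT : Continuous T) (hne : (invSet T).Nonempty)
    (g : C(X, ℝ) →ₗ[ℝ] ℝ) (hg : ∀ a, g a ≤ QFun T a) :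
    ∃ m ∈ invSet T, ∀ a : C(X, ℝ), ∫ x, a x ∂(m : Measure X) = g a := by
  have hpos : ∀ a : C(X, ℝ), 0 ≤ a → 0 ≤ g a := by
    intro a ha
    have h1 := hg (-a)
    have h2 : QFun T (-a) ≤ 0 := by
      refine aux_Q_le hne _ fun μ _ => integral_nonpos fun x => ?_
      simpa using ha x
    rw [map_neg] at h1
    linarith
  let Λ : CompactlySupportedContinuousMap X ℝ →ₚ[ℝ] ℝ :=
    { toFun := fun a => g (a : C(X, ℝ))
      map_add' := fun a b => by rw [← map_add]; rfl
      map_smul' := fun c a => by rw [← map_smul]; rfl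
      monotone' := fun a b hab => by
        have : 0 ≤ g ((b : C(X, ℝ)) - (a : C(X, ℝ))) := hpos _ (fun x => by
          have := hab x
          simpa using this)
        rw [map_sub] at this
        simpa using this }
  let M : Measure X := RealRMK.rieszMeasure Λ
  have hM : ∀ a : C(X, ℝ), ∫ x, a x ∂M = g a := by
    intro a
    let a' : CompactlySupportedContinuousMap X ℝ :=
      { toFun := a
        hasCompactSupport' := HasCompactSupport.of_compactSpace _ }
    exact RealRMK.integral_rieszMeasure Λ a'
  have hfin : IsFiniteMeasure M := by infer_instance
  have hone : g 1 = 1 := by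
    apply le_antisymm
    · refine (hg 1).trans (aux_Q_le hne _ fun μ _ => by simp)
    · have h1 := hg (-1)
      have h2 : QFun T (-1) ≤ -1 := aux_Q_le hne _ fun μ _ => by simp
      rw [map_neg] at h1
      linarith
  have hprob : IsProbabilityMeasure M := by
    have := hM 1
    rw [hone] at this
    simp [Measure.real] at this
    exact ⟨(ENNReal.toReal_eq_one_iff _).1 this⟩
  refine ⟨⟨M, hprob⟩, ?_, hM⟩
  change M.map T = M
  have : IsProbabilityMeasure (M.map T) := Measure.isProbabilityMeasure_map hT.measurable.aemeasurable
  apply ext_of_forall_integral_eq_of_IsFiniteMeasure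
  intro f
  rw [integral_map hT.measurable.aemeasurable f.continuous.aestronglyMeasurable]
  let a : C(X, ℝ) := f.toContinuousMap
  let b : C(X, ℝ) := a.comp ⟨T, hT⟩
  have hz : ∀ c : C(X, ℝ), ∀ μ ∈ invSet T,
      ∫ x, (c.comp ⟨T, hT⟩) x ∂(μ : Measure X) = ∫ x, c x ∂(μ : Measure X) := by
    intro c μ hμ
    have hμ' : (μ : Measure X).map T = (μ : Measure X) := hμ
    conv_rhs => rw [← hμ']
    rw [integral_map hT.measurable.aemeasurable c.continuous.aestronglyMeasurable]
    rfl
  have key : ∀ c : C(X, ℝ), g (c.comp ⟨T, hT⟩) ≤ g c := by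
    intro c
    have h1 := hg (c.comp ⟨T, hT⟩ - c)
    have h2 : QFun T (c.comp ⟨T, hT⟩ - c) ≤ 0 := by
      refine aux_Q_le hne _ fun μ hμ => ?_
      have := integral_sub (aux_integrable (c.comp ⟨T, hT⟩) (μ : Measure X))
        (aux_integrable c (μ : Measure X))
      simp only [ContinuousMap.sub_apply]
      rw [this, hz c μ hμ, sub_self]
    rw [map_sub] at h1
    linarith
  have k1 := key a
  have k2 := key (-a)
  have e : (-a).comp ⟨T, hT⟩ = -(a.comp ⟨T, hT⟩) := rfl
  rw [e, map_neg, map_neg] at k2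
  have : g b = g a := le_antisymm k1 (by simpa using k2)
  rw [← hM, ← hM] at this
  exact this

/-- Hahn-Banach sandwich. -/
lemma aux_hb {T : X → X} (hT : Continuous T) (hne : (invSet T).Nonempty) (φ : C(X, ℝ))
    (ℓ : C(X, ℝ) →ₗ[ℝ] ℝ) (hℓ : ∀ a, ℓ a ≤ QFun T a) (η : ℝ) (hη : 0 ≤ η)
    (h : ∀ a, ℓ a + QFun T φ ≤ QFun T (φ + a) + η * ‖a‖) :
    ∃ m ∈ maxSet T φ, ∀ a : C(X, ℝ), ℓ a - ∫ x, a x ∂(m : Measure X) ≤ η * ‖a‖ := by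
  let E := C(X, ℝ)
  let W : Submodule ℝ (E × E × ℝ) :=
    { carrier := {p | p.1 = p.2.1 + p.2.2 • φ}
      add_mem' := by
        rintro ⟨a, b, r⟩ ⟨a', b', r'⟩ h h'
        simp only [mem_ofPred_eq] at h h' ⊢
        simp only [Prod.mk_add_mk]
        rw [h, h']; module
      zero_mem' := by simp
      smul_mem' := by
        rintro c ⟨a, b, r⟩ h
        simp only [mem_ofPred_eq] at h ⊢
        simp only [Prod.smul_mk, smul_eq_mul]
        rw [h]; module }
  let L : E × E × ℝ →ₗ[ℝ] ℝ :=
    (ℓ.comp (LinearMap.fst ℝ E ℝ)).comp (LinearMap.snd ℝ E (E × ℝ)) +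
      (QFun T φ) • ((LinearMap.snd ℝ E ℝ).comp (LinearMap.snd ℝ E (E × ℝ)))
  have hL : ∀ p, L p = ℓ p.2.1 + QFun T φ * p.2.2 := fun p => rfl
  have hQ0 : QFun T 0 = 0 := by
    have := aux_Q_smul hne 2 (by norm_num) 0
    rw [smul_zero] at this; linarith
  obtain ⟨g, hg1, hg2⟩ := exists_extension_of_le_sublinear (E := E × E × ℝ) ⟨W, L.comp W.subtype⟩
    (fun p => QFun T p.1 + η * ‖p.2.1‖)
    (by
      intro c hc p
      simp only [Prod.smul_fst, Prod.smul_snd]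
      rw [aux_Q_smul hne c hc, norm_smul, Real.norm_of_nonneg hc.le]; ring)
    (by
      intro p q
      have h1 := aux_Q_add hne p.1 q.1
      have h2 := mul_le_mul_of_nonneg_left (norm_add_le p.2.1 q.2.1) hη
      simp only [Prod.fst_add, Prod.snd_add]
      linarith)
    (by
      rintro ⟨⟨u, a, r⟩, hp⟩
      have hu : u = a + r • φ := hp
      change L (u, a, r) ≤ QFun T u + η * ‖a‖
      rw [hL]
      change ℓ a + QFun T φ * r ≤ QFun T u + η * ‖a‖
      subst hu
      rcases lt_or_ge 0 r with hr | hr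
      · have h1 := h (r⁻¹ • a)
        have h2 : QFun T (a + r • φ) = r * QFun T (φ + r⁻¹ • a) := by
          rw [← aux_Q_smul hne r hr, smul_add, smul_smul, mul_inv_cancel₀ hr.ne', one_smul, add_comm]
        rw [map_smul, norm_smul, Real.norm_of_nonneg (by positivity : 0 ≤ r⁻¹), smul_eq_mul] at h1
        have h3 := mul_le_mul_of_nonneg_left h1 hr.le
        rw [h2]
        have e1 : r * (r⁻¹ * ℓ a + QFun T φ) = ℓ a + QFun T φ * r := by field_simp
        have e2 : r * (QFun T (φ + r⁻¹ • a) + η * (r⁻¹ * ‖a‖))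
          = r * QFun T (φ + r⁻¹ • a) + η * ‖a‖ := by field_simp
        linarith
      · have h0 : 0 ≤ η * ‖a‖ := by positivity
        rcases hr.lt_or_eq with hr | hr
        · have h1 := aux_Q_add hne (a + r • φ) ((-r) • φ)
          rw [aux_Q_smul hne (-r) (by linarith)] at h1
          have : a + r • φ + (-r) • φ = a := by module
          rw [this] at h1
          have := hℓ a
          linarith
        · subst hr
          have := hℓ a
          simp
          linarith)
  have hW : ∀ a r, g (a + r • φ, a, r) = ℓ a + QFun T φ * r := fun a r =>
    hg1 ⟨(a + r • φ, a, r), rfl⟩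
  let g1 : E →ₗ[ℝ] ℝ := g.comp (LinearMap.inl ℝ E (E × ℝ))
  have hg1' : ∀ a, g1 a = g (a, 0, 0) := fun a => rfl
  have hg1Q : ∀ a, g1 a ≤ QFun T a := by
    intro a
    have := hg2 (a, 0, 0)
    simpa [hg1'] using this
  have hr0 : g (0, 0, 1) = 0 := by
    have h1 := hg2 (0, 0, 1)
    have h2 := hg2 (-(0, 0, 1))
    rw [map_neg] at h2
    simp [hQ0] at h1 h2
    linarith
  obtain ⟨m, hm, hmg⟩ := aux_riesz hT hne g1 hg1Q
  refine ⟨m, ⟨hm, ?_⟩, ?_⟩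
  · rw [hmg, hg1']
    have h1 := hW 0 1
    have e : ((0 : E) + (1 : ℝ) • φ, (0 : E), (1 : ℝ)) = (φ, 0, 0) + (0, 0, 1) := by simp
    rw [e, map_add, hr0] at h1
    simpa using h1
  · intro a
    rw [hmg, hg1']
    have h1 := hW a 0
    have e : (a + (0 : ℝ) • φ, a, (0 : ℝ)) = (a, 0, 0) + (0, a, 0) := by simp
    rw [e, map_add] at h1
    have h2 := hg2 (0, a, 0)
    simp [hQ0] at h1 h2
    linarith

/-- Ekeland's variational principle. -/
lemma aux_ekeland {E : Type*} [MetricSpace E] [CompleteSpace E] (F : E → ℝ) (hF : Continuous F)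
    (h0 : ∀ x, 0 ≤ F x) (x₀ : E) (η : ℝ) (hη : 0 < η) :
    ∃ x, F x + η * dist x x₀ ≤ F x₀ ∧ ∀ y, F x ≤ F y + η * dist y x := by
  let S : E → Set E := fun x => {y | F y + η * dist y x ≤ F x}
  have hself : ∀ x, x ∈ S x := fun x => by
    change F x + η * dist x x ≤ F x
    simp
  have htrans : ∀ x y z, y ∈ S x → z ∈ S y → z ∈ S x := by
    intro x y z hy hz
    change F z + η * dist z x ≤ F x
    have h1 : F y + η * dist y x ≤ F x := hy
    have h2 : F z + η * dist z y ≤ F y := hz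
    have h3 := mul_le_mul_of_nonneg_left (dist_triangle z y x) hη.le
    linarith
  have hclosed : ∀ x, IsClosed (S x) := fun x =>
    isClosed_le (by fun_prop) continuous_const
  have hex : ∀ (x : E) (ε : ℝ), 0 < ε → ∃ z ∈ S x, ∀ y ∈ S x, F z ≤ F y + ε := by
    intro x ε hε
    have hne : (F '' S x).Nonempty := ⟨_, x, hself x, rfl⟩
    have hbdd : BddBelow (F '' S x) := ⟨0, by rintro _ ⟨y, -, rfl⟩; exact h0 y⟩
    obtain ⟨_, ⟨z, hz, rfl⟩, hlt⟩ := exists_lt_of_csInf_lt hne (lt_add_of_pos_right (sInf (F '' S x)) hε)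
    refine ⟨z, hz, fun y hy => ?_⟩
    have := csInf_le hbdd ⟨y, hy, rfl⟩
    linarith
  choose! nx hnx1 hnx2 using hex
  let u : ℕ → E := fun n => Nat.rec x₀ (fun n x => nx x ((1 / 2) ^ n)) n
  have hu : ∀ n, u (n + 1) = nx (u n) ((1 / 2) ^ n) := fun n => rfl
  have hp : ∀ n : ℕ, (0 : ℝ) < (1 / 2) ^ n := fun n => by positivity
  have hstep : ∀ n, u (n + 1) ∈ S (u n) := fun n => hu n ▸ hnx1 _ _ (hp n)
  have hmem : ∀ n k, u (n + k) ∈ S (u n) := by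
    intro n k
    induction k with
    | zero => exact hself _
    | succ k ih => exact htrans _ _ _ ih (hstep (n + k))
  have hsmall : ∀ n, ∀ y ∈ S (u (n + 1)), η * dist y (u (n + 1)) ≤ (1 / 2) ^ n := by
    intro n y hy
    have h1 : F y + η * dist y (u (n + 1)) ≤ F (u (n + 1)) := hy
    have h2 := hnx2 (u n) _ (hp n) y (htrans _ _ _ (hstep n) hy)
    rw [← hu n] at h2
    linarith
  have hsmall' : ∀ n, ∀ y ∈ S (u (n + 1)), dist y (u (n + 1)) ≤ (1 / 2) ^ n / η := by
    intro n y hy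
    rw [le_div_iff₀ hη, mul_comm]
    exact hsmall n y hy
  have hlim0 : Filter.Tendsto (fun n : ℕ => ((1 / 2 : ℝ)) ^ n / η) Filter.atTop (𝓝 0) := by
    have := (tendsto_pow_atTop_nhds_zero_of_lt_one (r := (1 / 2 : ℝ)) (by norm_num)
      (by norm_num)).div_const η
    simpa using this
  have hcau : CauchySeq (fun n => u (n + 1)) := by
    refine cauchySeq_of_le_tendsto_0' (fun n => (1 / 2 : ℝ) ^ n / η) ?_ hlim0
    intro n m hnm
    obtain ⟨k, rfl⟩ := Nat.exists_eq_add_of_le hnm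
    rw [dist_comm]
    apply hsmall'
    have := hmem (n + 1) k
    rwa [show n + 1 + k = n + k + 1 by ring] at this
  obtain ⟨x, hx⟩ := cauchySeq_tendsto_of_complete hcau
  have hxS : ∀ n, x ∈ S (u n) := by
    intro n
    refine (hclosed (u n)).mem_of_tendsto hx ?_
    filter_upwards [Filter.eventually_ge_atTop n] with m hm
    obtain ⟨k, rfl⟩ := Nat.exists_eq_add_of_le hm
    exact hmem n (k + 1)
  refine ⟨x, hxS 0, fun y => ?_⟩
  by_contra hlt
  push Not at hlt
  have hy : y ∈ S x := hlt.le
  have hyx : Filter.Tendsto (fun n => u (n + 1)) Filter.atTop (𝓝 y) := by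
    rw [tendsto_iff_dist_tendsto_zero]
    refine squeeze_zero (fun _ => dist_nonneg) (fun n => ?_) hlim0
    rw [dist_comm]
    exact hsmall' n y (htrans _ _ _ (hxS (n + 1)) hy)
  have := tendsto_nhds_unique hx hyx
  subst this
  simp at hlt

/-- Integration as a linear functional. -/
noncomputable def auxInt (μ : ProbabilityMeasure X) : C(X, ℝ) →ₗ[ℝ] ℝ where
  toFun a := ∫ x, a x ∂(μ : Measure X)
  map_add' a b := integral_add (aux_integrable a _) (aux_integrable b _)
  map_smul' c a := by simp [integral_const_mul]

lemma auxInt_apply (μ : ProbabilityMeasure X) (a : C(X, ℝ)) :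
    auxInt μ a = ∫ x, a x ∂(μ : Measure X) := rfl

lemma aux_exists_max {T : X → X} (hT : Continuous T) (hne : (invSet T).Nonempty) (φ : C(X, ℝ)) :
    (maxSet T φ).Nonempty := by
  obtain ⟨μ, hμ⟩ := hne
  obtain ⟨m, hm, -⟩ := aux_hb hT ⟨μ, hμ⟩ φ (auxInt μ) (fun a => aux_le_Q a hμ) 2 (by norm_num) (by
    intro a
    have h1 := aux_Q_lip ⟨μ, hμ⟩ φ (φ + a)
    have h2 := (abs_le.1 (aux_abs_le a μ)).2
    have : φ - (φ + a) = -a := by abel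
    rw [this, norm_neg] at h1
    rw [auxInt_apply]
    linarith)
  exact ⟨m, hm⟩

noncomputable def auxFun (μ : ProbabilityMeasure X) : WeakDual ℝ C(X, ℝ) :=
  StrongDual.toWeakDual ((auxInt μ).mkContinuous 1 (fun a => by
    rw [one_mul]; exact aux_abs_le a μ))

lemma auxFun_apply (μ : ProbabilityMeasure X) (a : C(X, ℝ)) :
    auxFun μ a = ∫ x, a x ∂(μ : Measure X) := rfl

lemma auxFun_inj {μ ν : ProbabilityMeasure X} (h : auxFun μ = auxFun ν) : μ = ν := by
  apply Subtype.ext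
  have i1 : IsFiniteMeasure (Subtype.val μ) := inferInstanceAs (IsFiniteMeasure (μ : Measure X))
  have i2 : IsFiniteMeasure (Subtype.val ν) := inferInstanceAs (IsFiniteMeasure (ν : Measure X))
  apply ext_of_forall_integral_eq_of_IsFiniteMeasure
  intro f
  have : auxFun μ f.toContinuousMap = auxFun ν f.toContinuousMap := by rw [h]
  exact this

/-- There is an ergodic maximizing measure. -/
lemma aux_exists_erg_max {T : X → X} (hT : Continuous T) (hne : (invSet T).Nonempty)
    (φ : C(X, ℝ)) : ∃ m ∈ maxSet T φ, m ∈ ergSet T := by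
  let K : Set (WeakDual ℝ C(X, ℝ)) := {g | (∀ a, g a ≤ QFun T a) ∧ g φ = QFun T φ}
  have hKmem : ∀ m ∈ maxSet T φ, auxFun m ∈ K := fun m hm =>
    ⟨fun a => aux_le_Q a hm.1, hm.2⟩
  have hKne : K.Nonempty := by
    obtain ⟨m, hm⟩ := aux_exists_max hT hne φ
    exact ⟨_, hKmem m hm⟩
  have hKcl : IsClosed K := by
    have : K = (⋂ a, {g : WeakDual ℝ C(X, ℝ) | g a ≤ QFun T a}) ∩
        {g : WeakDual ℝ C(X, ℝ) | g φ = QFun T φ} := by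
      ext g; simp [K]
    rw [this]
    refine IsClosed.inter (isClosed_iInter fun a => ?_) ?_
    · exact isClosed_le (WeakDual.eval_continuous a) continuous_const
    · exact isClosed_eq (WeakDual.eval_continuous φ) continuous_const
  have hKc : IsCompact K := by
    refine (WeakDual.isCompact_closedBall (𝕜 := ℝ) (E := C(X, ℝ)) 0 1).of_isClosed_subset hKcl ?_
    intro g hg
    simp only [mem_preimage, mem_closedBall_zero_iff]
    refine ContinuousLinearMap.opNorm_le_bound _ zero_le_one fun a => ?_
    rw [one_mul, Real.norm_eq_abs, abs_le]
    have h1 := (hg.1 a).trans (aux_Q_norm hne a)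
    have h2 := (hg.1 (-a)).trans (aux_Q_norm hne (-a))
    rw [map_neg, norm_neg] at h2
    constructor
    · change -‖a‖ ≤ g a
      linarith
    · exact h1
  have hlc : LocallyConvexSpace ℝ (WeakDual ℝ C(X, ℝ)) :=
    inferInstanceAs (LocallyConvexSpace ℝ (WeakBilin (topDualPairing ℝ C(X, ℝ))))
  obtain ⟨g, hg⟩ := hKc.extremePoints_nonempty hKne
  obtain ⟨m, hm, hmg⟩ := aux_riesz hT hne (g : C(X, ℝ) →ₗ[ℝ] ℝ) hg.1.1
  have hgm : auxFun m = g := by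
    refine DFunLike.ext _ _ fun a => ?_
    rw [auxFun_apply, hmg]; rfl
  have hmax : m ∈ maxSet T φ := ⟨hm, by rw [hmg]; exact hg.1.2⟩
  refine ⟨m, hmax, ?_⟩
  change Ergodic T (m : Measure X)
  apply Ergodic.of_mem_extremePoints
  rw [mem_extremePoints_iff_left]
  refine ⟨⟨⟨hT.measurable, hm⟩, inferInstance⟩, ?_⟩
  rintro ν₁ ⟨hfν₁, hp₁⟩ ν₂ ⟨hfν₂, hp₂⟩ ⟨s, t, hs, ht, hst, hmeq⟩
  have hs1 : s ≠ ∞ := fun h => by simp [h] at hst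
  have ht1 : t ≠ ∞ := fun h => by simp [h] at hst
  let n₁ : ProbabilityMeasure X := ⟨ν₁, hp₁⟩
  let n₂ : ProbabilityMeasure X := ⟨ν₂, hp₂⟩
  have hn₁ : n₁ ∈ invSet T := hfν₁.map_eq
  have hn₂ : n₂ ∈ invSet T := hfν₂.map_eq
  have hs0 : 0 < s.toReal := ENNReal.toReal_pos hs.ne' hs1
  have ht0 : 0 < t.toReal := ENNReal.toReal_pos ht.ne' ht1
  have hst' : s.toReal + t.toReal = 1 := by
    rw [← ENNReal.toReal_add hs1 ht1, hst, ENNReal.toReal_one]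
  have hint : ∀ a : C(X, ℝ), ∫ x, a x ∂(m : Measure X) =
      s.toReal * ∫ x, a x ∂ν₁ + t.toReal * ∫ x, a x ∂ν₂ := by
    intro a
    rw [← hmeq, integral_add_measure ((aux_integrable a ν₁).smul_measure hs1)
      ((aux_integrable a ν₂).smul_measure ht1), integral_smul_measure, integral_smul_measure]
    rfl
  have hφ := hint φ
  rw [hmax.2] at hφ
  have q1 : ∫ x, φ x ∂ν₁ ≤ QFun T φ := aux_le_Q φ hn₁
  have q2 : ∫ x, φ x ∂ν₂ ≤ QFun T φ := aux_le_Q φ hn₂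
  have e1 : n₁ ∈ maxSet T φ := ⟨hn₁, le_antisymm q1 (by
    change QFun T φ ≤ ∫ x, φ x ∂ν₁
    by_contra hc
    push Not at hc
    have k1 := mul_lt_mul_of_pos_left hc hs0
    have k2 := mul_le_mul_of_nonneg_left q2 ht0.le
    have k3 : s.toReal * QFun T φ + t.toReal * QFun T φ = QFun T φ := by
      rw [← add_mul, hst', one_mul]
    linarith)⟩
  have e2 : n₂ ∈ maxSet T φ := ⟨hn₂, le_antisymm q2 (by
    change QFun T φ ≤ ∫ x, φ x ∂ν₂
    by_contra hc
    push Not at hc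
    have k1 := mul_lt_mul_of_pos_left hc ht0
    have k2 := mul_le_mul_of_nonneg_left q1 hs0.le
    have k3 : s.toReal * QFun T φ + t.toReal * QFun T φ = QFun T φ := by
      rw [← add_mul, hst', one_mul]
    linarith)⟩
  have hfin := ((mem_extremePoints_iff_left (𝕜 := ℝ)).1 hg).2 _ (hKmem _ e1) _ (hKmem _ e2)
    ⟨s.toReal, t.toReal, hs0, ht0, hst', by
      rw [← hgm]
      refine DFunLike.ext _ _ fun a => ?_
      rw [auxFun_apply, hint a]; rfl⟩
  have : n₁ = m := auxFun_inj (hfin.trans hgm.symm)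
  exact congrArg Subtype.val this

lemma aux_sing {m μ : ProbabilityMeasure X}
    (h : ∀ a : C(X, ℝ), ∫ x, a x ∂(μ : Measure X) - ∫ x, a x ∂(m : Measure X) ≤ 1 / 2 * ‖a‖) :
    ¬ ((m : Measure X) ⟂ₘ (μ : Measure X)) := by
  rintro ⟨s, hs, hms, hμs⟩
  have hμ1 : (μ : Measure X) s = 1 := (prob_compl_eq_zero_iff hs).1 hμs
  obtain ⟨K, hKs, hK, hKlt⟩ := hs.exists_isClosed_lt_add (μ := (μ : Measure X)) (measure_ne_top _ _)
    (ε := ENNReal.ofReal (1 / 4)) (by simp)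
  obtain ⟨U, hKU, hU, hUlt⟩ := K.exists_isOpen_lt_of_lt (μ := (m : Measure X))
    (ENNReal.ofReal (1 / 4)) (by rw [measure_mono_null hKs hms]; simp)
  obtain ⟨a, ha0, ha1, ha⟩ := exists_continuous_zero_one_of_isClosed hU.isClosed_compl hK
    (disjoint_left.2 fun x hx hx' => hx (hKU hx'))
  have hna : ‖a‖ ≤ 1 := (ContinuousMap.norm_le _ zero_le_one).2 fun x => by
    rw [Real.norm_of_nonneg (ha x).1]; exact (ha x).2
  have e1 : (μ : Measure X).real K ≤ ∫ x, a x ∂(μ : Measure X) := by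
    rw [← integral_indicator_one hK.measurableSet]
    refine integral_mono ((integrable_const (1 : ℝ)).indicator hK.measurableSet)
      (aux_integrable a _) fun x => ?_
    by_cases hx : x ∈ K
    · simp [hx, ha1 hx]
    · simpa [hx] using (ha x).1
  have e2 : ∫ x, a x ∂(m : Measure X) ≤ (m : Measure X).real U := by
    rw [← integral_indicator_one hU.measurableSet]
    refine integral_mono (aux_integrable a _)
      ((integrable_const (1 : ℝ)).indicator hU.measurableSet) fun x => ?_
    by_cases hx : x ∈ U
    · simpa [hx] using (ha x).2
    · simp [hx, ha0 (show x ∈ Uᶜ from hx)]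
  have e3 : (m : Measure X).real U < 1 / 4 := by
    rw [Measure.real, ← ENNReal.toReal_ofReal (show (0 : ℝ) ≤ 1 / 4 by norm_num)]
    exact (ENNReal.toReal_lt_toReal (measure_ne_top _ _) ENNReal.ofReal_ne_top).2 hUlt
  have e4 : 1 < (μ : Measure X).real K + 1 / 4 := by
    rw [hμ1] at hKlt
    have := (ENNReal.toReal_lt_toReal (by simp)
      (ENNReal.add_ne_top.2 ⟨measure_ne_top _ _, ENNReal.ofReal_ne_top⟩)).2 hKlt
    rw [ENNReal.toReal_add (measure_ne_top _ _) ENNReal.ofReal_ne_top,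
      ENNReal.toReal_ofReal (by norm_num)] at this
    simpa [Measure.real] using this
  have := h a
  linarith

lemma aux_lint (φ : C(X, ℝ)) (ν : Measure X) [IsFiniteMeasure ν] :
    ∫⁻ x, ENNReal.ofReal (φ x + ‖φ‖) ∂ν
      = ENNReal.ofReal (∫ x, φ x ∂ν + ‖φ‖ * ν.real univ) := by
  rw [← ofReal_integral_eq_lintegral_ofReal]
  · rw [integral_add (aux_integrable φ ν) (integrable_const _)]
    simp [mul_comm]
  · exact (aux_integrable φ ν).add (integrable_const _)
  · refine Filter.Eventually.of_forall fun x => ?_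
    have := (abs_le.1 (φ.norm_coe_le_norm x)).1
    simp only [Pi.zero_apply]
    linarith

lemma aux_fin_le {T : X → X} (hT : Continuous T) (φ : C(X, ℝ)) (ν : Measure X)
    [IsFiniteMeasure ν] (hν : MeasurePreserving T ν ν) :
    ∫ x, φ x ∂ν ≤ QFun T φ * ν.real univ := by
  rcases eq_or_ne ν 0 with rfl | h0
  · simp
  have h1 : ν univ ≠ 0 := by simpa using h0
  have hp : IsProbabilityMeasure ((ν univ)⁻¹ • ν) := by
    constructor
    simp [ENNReal.inv_mul_cancel h1 (measure_ne_top _ _)]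
  have hinv : (⟨(ν univ)⁻¹ • ν, hp⟩ : ProbabilityMeasure X) ∈ invSet T := by
    change ((ν univ)⁻¹ • ν).map T = (ν univ)⁻¹ • ν
    rw [Measure.map_smul, hν.map_eq]
  have h2 := aux_le_Q φ hinv
  change ∫ x, φ x ∂((ν univ)⁻¹ • ν) ≤ _ at h2
  rw [integral_smul_measure, ENNReal.toReal_inv, smul_eq_mul] at h2
  have h3 : 0 < ν.real univ := ENNReal.toReal_pos h1 (measure_ne_top _ _)
  change (ν.real univ)⁻¹ * _ ≤ _ at h2
  rw [inv_mul_le_iff₀ h3] at h2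
  linarith

lemma aux_meas (F : unitInterval → ProbabilityMeasure X) (hF : Continuous F) :
    Measurable (fun t => (F t : Measure X)) := by
  refine Measurable.measure_of_isPiSystem_of_isProbabilityMeasure
    (S := {U : Set X | IsOpen U}) (BorelSpace.measurable_eq) isPiSystem_isOpen ?_
  intro U hU
  apply LowerSemicontinuous.measurable
  rw [lowerSemicontinuous_iff_le_liminf]
  intro t
  exact ProbabilityMeasure.le_liminf_measure_open_of_tendsto hF.continuousAt hU

/-- The average of a path of measures. -/
lemma aux_avg {T : X → X} (hT : Continuous T) (F : unitInterval → ProbabilityMeasure X)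
    (hF : Continuous F) (hinv : ∀ t, F t ∈ invSet T) :
    ∃ μ ∈ invSet T, (μ : Measure X) = (volume : Measure unitInterval).bind
      (fun t => (F t : Measure X)) := by
  have hm := aux_meas F hF
  have hp : IsProbabilityMeasure ((volume : Measure unitInterval).bind
      (fun t => (F t : Measure X))) := by
    constructor
    rw [Measure.bind_apply MeasurableSet.univ hm.aemeasurable]
    simp
  refine ⟨⟨_, hp⟩, ?_, rfl⟩
  change Measure.map T (Measure.bind _ _) = Measure.bind _ _
  ext s hs
  rw [Measure.map_apply hT.measurable hs, Measure.bind_apply (hT.measurable hs) hm.aemeasurable,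
    Measure.bind_apply hs hm.aemeasurable]
  congr 1
  ext t
  rw [← Measure.map_apply hT.measurable hs]
  have : (F t : Measure X).map T = F t := hinv t
  rw [this]

lemma aux_erg_inv {T : X → X} {μ : ProbabilityMeasure X} (h : μ ∈ ergSet T) : μ ∈ invSet T := by
  have h' : Ergodic T (μ : Measure X) := h
  exact h'.toMeasurePreserving.map_eq

lemma aux_key {T : X → X} (hT : Continuous T) (F : unitInterval → ProbabilityMeasure X)
    (hF : Continuous F) (herg : ∀ t, F t ∈ ergSet T) (φ : C(X, ℝ))
    (μ m : ProbabilityMeasure X) (hμ : μ ∈ invSet T)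
    (hμF : (μ : Measure X) = (volume : Measure unitInterval).bind (fun t => (F t : Measure X)))
    (hm : m ∈ maxSet T φ)
    (h : ∀ a : C(X, ℝ), ∫ x, a x ∂(μ : Measure X) - ∫ x, a x ∂(m : Measure X) ≤ 1 / 2 * ‖a‖) :
    ¬ {t | F t ∈ maxSet T φ}.Countable := by
  intro hcount
  apply aux_sing h
  have hFm := aux_meas F hF
  have hpm : MeasurePreserving T (m : Measure X) (m : Measure X) := ⟨hT.measurable, hm.1⟩
  have hpμ : MeasurePreserving T (μ : Measure X) (μ : Measure X) := ⟨hT.measurable, hμ⟩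
  set M : Measure X := (m : Measure X) with hM
  set N : Measure X := (μ : Measure X) with hN
  set d := M.rnDeriv N with hd
  have hdm : Measurable d := Measure.measurable_rnDeriv _ _
  have hac := hpm.withDensity_rnDeriv hpμ
  have hsi := hpm.singularPart hpμ
  have hcomp := hpm.rnDeriv_comp_aeEq hpμ
  have hsum := Measure.haveLebesgueDecomposition_add M N
  have hacfin : IsFiniteMeasure (N.withDensity d) := inferInstance
  have b1 := aux_fin_le hT φ _ hac
  have b2 := aux_fin_le hT φ _ hsi
  have b3 : ∫ x, φ x ∂M = ∫ x, φ x ∂(M.singularPart N) + ∫ x, φ x ∂(N.withDensity d) := by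
    conv_lhs => rw [hsum]
    exact integral_add_measure (aux_integrable φ _) (aux_integrable φ _)
  have b4 : M.real univ = (M.singularPart N).real univ + (N.withDensity d).real univ := by
    conv_lhs => rw [hsum]
    exact measureReal_add_apply
  have b5 : M.real univ = 1 := by simp [hM]
  have b6 : ∫ x, φ x ∂M = QFun T φ := hm.2
  have b7 : ∫ x, φ x ∂(N.withDensity d) = QFun T φ * (N.withDensity d).real univ := by
    apply le_antisymm b1
    have : QFun T φ = QFun T φ * (M.singularPart N).real univ
      + QFun T φ * (N.withDensity d).real univ := by
      rw [← mul_add, ← b4, b5, mul_one]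
    linarith
  let ψ : X → ℝ≥0∞ := fun x => ENNReal.ofReal (φ x + ‖φ‖)
  have hψ : Measurable ψ := by
    have : Continuous ψ :=
      ENNReal.continuous_ofReal.comp (φ.continuous.add continuous_const)
    exact this.measurable
  have hQ0 : 0 ≤ QFun T φ + ‖φ‖ := by
    have h1 := aux_le_Q φ hμ
    have h2 := (abs_le.1 (aux_abs_le φ μ)).1
    linarith
  set q := ENNReal.ofReal (QFun T φ + ‖φ‖) with hq
  have c1 : ∫⁻ x, ψ x ∂(N.withDensity d) = q * (N.withDensity d) univ := by
    rw [aux_lint, b7, ← add_mul, ENNReal.ofReal_mul hQ0, ofReal_measureReal]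
  let H : unitInterval → ℝ≥0∞ := fun t => ∫⁻ x, d x ∂(F t : Measure X)
  let P : unitInterval → ℝ≥0∞ := fun t => ∫⁻ x, ψ x ∂(F t : Measure X)
  have hHm : Measurable H := (Measure.measurable_lintegral hdm).comp hFm
  have hPm : Measurable P := (Measure.measurable_lintegral hψ).comp hFm
  have c2 : (N.withDensity d) univ = ∫⁻ t, H t := by
    rw [withDensity_apply _ MeasurableSet.univ, Measure.restrict_univ, hμF,
      Measure.lintegral_bind hFm.aemeasurable hdm.aemeasurable]
  have c3 : ∫⁻ x, ψ x ∂(N.withDensity d) = ∫⁻ t, H t * P t := by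
    rw [lintegral_withDensity_eq_lintegral_mul _ hdm hψ, hμF,
      Measure.lintegral_bind hFm.aemeasurable (hdm.mul hψ).aemeasurable]
    have hae : ∀ᵐ t, ∀ᵐ x ∂(F t : Measure X), (d ∘ T) x = d x := by
      apply Measure.ae_ae_of_ae_bind hFm.aemeasurable
      rw [← hμF]
      exact hcomp
    refine lintegral_congr_ae ?_
    filter_upwards [hae] with t ht
    have het : Ergodic T (F t : Measure X) := herg t
    obtain ⟨c, hc⟩ := het.ae_eq_const_of_ae_eq_comp₀ hdm.nullMeasurable ht
    have f1 : H t = c := by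
      change ∫⁻ x, d x ∂(F t : Measure X) = c
      rw [lintegral_congr_ae hc]
      simp
    rw [f1]
    have f2 : ∫⁻ x, (d * ψ) x ∂(F t : Measure X) = ∫⁻ x, c * ψ x ∂(F t : Measure X) := by
      refine lintegral_congr_ae ?_
      filter_upwards [hc] with x hx
      simp only [Pi.mul_apply]
      rw [hx]; rfl
    rw [f2, lintegral_const_mul _ hψ]
  have hPt : ∀ t, P t = ENNReal.ofReal (∫ x, φ x ∂(F t : Measure X) + ‖φ‖) := by
    intro t
    change ∫⁻ x, ENNReal.ofReal (φ x + ‖φ‖) ∂(F t : Measure X) = _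
    rw [aux_lint]; simp
  have hPq : ∀ t, P t ≤ q := by
    intro t
    rw [hPt]
    apply ENNReal.ofReal_le_ofReal
    have := aux_le_Q φ (aux_erg_inv (herg t))
    linarith
  have hPlt : ∀ᵐ t, P t < q := by
    have : ∀ᵐ t : unitInterval, t ∉ {t | F t ∈ maxSet T φ} :=
      measure_eq_zero_iff_ae_notMem.1 (hcount.measure_zero volume)
    filter_upwards [this] with t ht
    rw [hPt]
    have h1 := aux_le_Q φ (aux_erg_inv (herg t))
    have h2 : ∫ x, φ x ∂(F t : Measure X) < QFun T φ :=
      lt_of_le_of_ne h1 fun he => ht ⟨aux_erg_inv (herg t), he⟩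
    have h3 := (abs_le.1 (aux_abs_le φ (F t))).1
    exact (ENNReal.ofReal_lt_ofReal_iff (by linarith)).2 (by linarith)
  have hHfin : ∫⁻ t, H t ≠ ∞ := by
    rw [← c2]; exact measure_ne_top _ _
  have hqfin : q ≠ ∞ := ENNReal.ofReal_ne_top
  have c4 : ∫⁻ t, H t * q = ∫⁻ t, H t * P t := by
    rw [lintegral_mul_const _ hHm, ← c3, c1, c2, mul_comm]
  have c5 : (fun t => H t * P t) =ᵐ[volume] fun t => H t * q := by
    refine ae_eq_of_ae_le_of_lintegral_le
      (Filter.Eventually.of_forall fun t => mul_le_mul_right (hPq t) (H t)) ?_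
      (hHm.mul_const q).aemeasurable c4.le
    rw [← c4, lintegral_mul_const _ hHm]
    exact ENNReal.mul_ne_top hHfin hqfin
  have c6 : H =ᵐ[volume] 0 := by
    filter_upwards [c5, hPlt, ae_lt_top hHm hHfin] with t h1 h2 h3
    by_contra h4
    exact h2.ne ((ENNReal.mul_right_inj h4 h3.ne).1 h1)
  have c7 : (N.withDensity d) = 0 := by
    rw [← Measure.measure_univ_eq_zero, c2, lintegral_congr_ae c6]
    simp
  rw [← hd, c7, add_zero] at hsum
  rw [hsum]
  exact Measure.mutuallySingular_singularPart _ _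

lemma aux_avg_ge (F : unitInterval → ProbabilityMeasure X)
    (hF : Continuous F) (φ : C(X, ℝ)) (μ : ProbabilityMeasure X)
    (hμF : (μ : Measure X) = (volume : Measure unitInterval).bind (fun t => (F t : Measure X)))
    (c : ℝ) (hc : ∀ t, c ≤ ∫ x, φ x ∂(F t : Measure X)) : c ≤ ∫ x, φ x ∂(μ : Measure X) := by
  have hFm := aux_meas F hF
  have hψ : Measurable fun x => ENNReal.ofReal (φ x + ‖φ‖) := by
    have : Continuous fun x => ENNReal.ofReal (φ x + ‖φ‖) :=
      ENNReal.continuous_ofReal.comp (φ.continuous.add continuous_const)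
    exact this.measurable
  have h1 : ENNReal.ofReal (c + ‖φ‖) ≤ ENNReal.ofReal (∫ x, φ x ∂(μ : Measure X) + ‖φ‖) := by
    have e := aux_lint φ (μ : Measure X)
    simp only [probReal_univ, mul_one] at e
    rw [← e, hμF, Measure.lintegral_bind hFm.aemeasurable hψ.aemeasurable]
    calc ENNReal.ofReal (c + ‖φ‖) = ∫⁻ t : unitInterval, ENNReal.ofReal (c + ‖φ‖) := by simp
      _ ≤ _ := by
        refine lintegral_mono fun t => ?_
        have e := aux_lint φ (F t : Measure X)
        simp only [probReal_univ, mul_one] at e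
        rw [e]
        exact ENNReal.ofReal_le_ofReal (by linarith [hc t])
  have h3 := (abs_le.1 (aux_abs_le φ μ)).1
  rw [ENNReal.ofReal_le_ofReal_iff (by linarith)] at h1
  linarith

lemma aux_main {T : X → X} (hT : Continuous T) (hne : (invSet T).Nonempty)
    (F : unitInterval → ProbabilityMeasure X)
    (hF : Continuous F) (herg : ∀ t, F t ∈ ergSet T) (φ₀ : C(X, ℝ)) (ε : ℝ)
    (hc : ∀ t, QFun T φ₀ - ε / 2 ≤ ∫ x, φ₀ x ∂(F t : Measure X)) :
    ∃ φ : C(X, ℝ), dist φ φ₀ ≤ ε ∧ ¬ {t | F t ∈ maxSet T φ}.Countable := by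
  obtain ⟨μ, hμ, hμF⟩ := aux_avg hT F hF fun t => aux_erg_inv (herg t)
  have hge := aux_avg_ge F hF φ₀ μ hμF _ hc
  have hQc : Continuous (fun φ => QFun T φ) := by
    refine (LipschitzWith.of_le_add (fun φ ψ => ?_)).continuous
    rw [dist_eq_norm]
    exact aux_Q_lip hne φ ψ
  have hIc : Continuous (fun φ => auxInt μ φ) := by
    refine (LipschitzWith.of_le_add (fun φ ψ => ?_)).continuous
    rw [dist_eq_norm]
    have := (abs_le.1 (aux_abs_le (φ - ψ) μ)).2
    rw [← auxInt_apply, map_sub] at this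
    linarith
  obtain ⟨φ, h1, h2⟩ := aux_ekeland (fun φ => QFun T φ - auxInt μ φ) (hQc.sub hIc)
    (fun φ => sub_nonneg.2 (aux_le_Q φ hμ)) φ₀ (1 / 2) (by norm_num)
  refine ⟨φ, ?_, ?_⟩
  · have h3 : 0 ≤ QFun T φ - auxInt μ φ := sub_nonneg.2 (aux_le_Q φ hμ)
    simp only [auxInt_apply] at h1 h3
    linarith
  · obtain ⟨m, hm, hmle⟩ := aux_hb hT hne φ (auxInt μ) (fun a => aux_le_Q a hμ) (1 / 2)
      (by norm_num) (by
        intro a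
        have := h2 (φ + a)
        simp only [map_add, dist_eq_norm, add_sub_cancel_left] at this
        linarith)
    exact aux_key hT F hF herg φ μ m hμ hμF hm hmle

end Aux

/-- (Theorem B) For a topologically mixing subshift of finite type (given here via
Sigmund's path theorem, its two distinct ergodic measures, and nonemptiness of `M(X,T)`),
there is a dense set of continuous functions each of which has uncountably many ergodic
maximizing measures that are fully supported and have positive metric entropy. -/
theorem stmt18 [MeasurableSpace (ProbabilityMeasure X)] [BorelSpace (ProbabilityMeasure X)]
    (T : X → X) (hT : Continuous T) (hne : (invSet T).Nonempty)
    (htwo : ∃ μ ∈ ergSet T, ∃ ν ∈ ergSet T, μ ≠ ν)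
    (hSigmund : ∀ μ ∈ ergSet T, ∀ ν ∈ ergSet T,
      ∃ f : unitInterval → ProbabilityMeasure X,
        Continuous f ∧ Set.range f ⊆ ergSet T ∧ f 0 = μ ∧ f 1 = ν ∧
        (∀ m : ProbabilityMeasure X, (f ⁻¹' {m}).Countable) ∧
        ∃ E : Set (ProbabilityMeasure X), E.Countable ∧
          ∀ m ∈ Set.range f \ E,
            (m : Measure X).IsOpenPosMeasure ∧ 0 < ksEntropy T (m : Measure X)) :
    ∃ D : Set C(X, ℝ), Dense D ∧ ∀ φ ∈ D,
      ¬ {m : ProbabilityMeasure X | m ∈ maxSet T φ ∧ m ∈ ergSet T ∧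
          (m : Measure X).IsOpenPosMeasure ∧ 0 < ksEntropy T (m : Measure X)}.Countable := by
  classical
  refine ⟨{φ | ¬ {m : ProbabilityMeasure X | m ∈ maxSet T φ ∧ m ∈ ergSet T ∧
          (m : Measure X).IsOpenPosMeasure ∧ 0 < ksEntropy T (m : Measure X)}.Countable},
    ?_, fun φ hφ => hφ⟩
  rw [Metric.dense_iff]
  intro φ₀ r hr
  obtain ⟨m₀, hm₀, hm₀e⟩ := aux_exists_erg_max hT hne φ₀
  obtain ⟨μ₁, hμ₁, μ₂, hμ₂, hne'⟩ := htwo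
  obtain ⟨f, hfc, hfr, hf0, hf1, hfpre, E, hE, hEr⟩ := hSigmund m₀ hm₀e μ₁ hμ₁
  have hIc : Continuous (fun t => ∫ x, φ₀ x ∂(f t : Measure X)) := by
    have h1 := ProbabilityMeasure.continuous_integral_boundedContinuousFunction
      (BoundedContinuousFunction.mkOfCompact φ₀)
    exact h1.comp hfc
  have hlt : QFun T φ₀ - (r / 2) / 2 < ∫ x, φ₀ x ∂(f 0 : Measure X) := by
    rw [hf0, hm₀.2]; linarith
  have hev := hIc.continuousAt.eventually (lt_mem_nhds hlt)
  obtain ⟨δ, hδ, hball⟩ := Metric.eventually_nhds_iff.1 hev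
  let d : unitInterval := ⟨min (δ / 2) 1, by positivity, min_le_right _ _⟩
  have hd : 0 < (d : ℝ) := lt_min (by positivity) one_pos
  have hdδ : (d : ℝ) < δ := lt_of_le_of_lt (min_le_left _ _) (by linarith)
  let F : unitInterval → ProbabilityMeasure X := fun t => f (d * t)
  have hFc : Continuous F := hfc.comp (by fun_prop)
  have hFe : ∀ t, F t ∈ ergSet T := fun t => hfr ⟨_, rfl⟩
  have hFge : ∀ t, QFun T φ₀ - (r / 2) / 2 ≤ ∫ x, φ₀ x ∂(F t : Measure X) := by
    intro t
    refine (hball (y := d * t) ?_).le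
    rw [Subtype.dist_eq, Real.dist_eq]
    change |(d : ℝ) * (t : ℝ) - 0| < δ
    rw [sub_zero]
    rw [abs_of_nonneg (mul_nonneg hd.le t.2.1)]
    have := mul_le_mul_of_nonneg_left t.2.2 hd.le
    linarith
  obtain ⟨φ, hφ, hunc⟩ := aux_main hT hne F hFc hFe φ₀ (r / 2) hFge
  refine ⟨φ, ?_, ?_⟩
  · rw [Metric.mem_ball]; linarith
  · intro hcount
    apply hunc
    have hFpre : ∀ m, (F ⁻¹' {m}).Countable := by
      intro m
      refine (hfpre m).preimage_of_injOn (f := fun t => d * t) ?_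
      intro s _ t _ hst
      have : (d : ℝ) * s = d * t := congrArg Subtype.val hst
      exact Subtype.ext (mul_left_cancel₀ hd.ne' this)
    have hbig := (hcount.union hE).biUnion fun m _ => hFpre m
    refine hbig.mono fun t ht => ?_
    simp only [mem_iUnion]
    refine ⟨F t, ?_, rfl⟩
    by_cases hFE : F t ∈ E
    · exact Or.inr hFE
    · have := hEr (F t) ⟨⟨_, rfl⟩, hFE⟩
      exact Or.inl ⟨ht, hFe t, this.1, this.2⟩
end
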